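/- arXiv:2105.02722 — 2 statements merged into one kernel-verified Lean document; each statement's English description precedes it below -/
import Mathlib

section
/- Let G_1=(V_1,E_1) and G_2=(V_2,E_2) be finite simple graphs with V_1 and V_2 nonempty, and let J = G_1 + G_2 be their join. If μ(G_1) < |V_1| − 1 and μ(G_2) < |V_2| − 1, then μ(J) = |V_1| + |V_2| − 2. -/
open SimpleGraph

attribute [local instance] Classical.propDecidable

/-- Two vertices `u`, `v` of a set of points `P` are mutually visible in `G` if there is a
shortest `u,v`-path (a walk whose length equals the distance `G.dist u v`) none of whose
internal vertices lies in `P`. -/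
def SimpleGraph.MutuallyVisible {V : Type*} (G : SimpleGraph V) (P : Set V) (u v : V) : Prop :=
  ∃ p : G.Walk u v, p.length = G.dist u v ∧ ∀ w ∈ p.support.tail.dropLast, w ∉ P

/-- `P` is a mutual-visibility set of `G` if every two distinct points of `P`
are mutually visible. -/
def SimpleGraph.IsMVSet {V : Type*} (G : SimpleGraph V) (P : Set V) : Prop :=
  ∀ u ∈ P, ∀ v ∈ P, u ≠ v → G.MutuallyVisible P u v

/-- The mutual-visibility number `μ(G)`: the maximum cardinality of a
mutual-visibility set of `G`. -/
noncomputable def SimpleGraph.mutualVisibilityNumber {V : Type*} [Fintype V]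
    (G : SimpleGraph V) : ℕ :=
  sSup {n | ∃ P : Set V, G.IsMVSet P ∧ P.ncard = n}

/-- A vertex set `S` is convex in `G` if every shortest path in `G` between two vertices of `S`
has all of its vertices in `S`. -/
def SimpleGraph.IsConvexSet {V : Type*} (G : SimpleGraph V) (S : Set V) : Prop :=
  ∀ u ∈ S, ∀ v ∈ S, ∀ p : G.Walk u v, p.length = G.dist u v → ∀ w ∈ p.support, w ∈ S

/-- The convex hull of a set `A` of vertices: the smallest convex set containing `A`. -/
def SimpleGraph.convexHullSet {V : Type*} (G : SimpleGraph V) (A : Set V) : Set V :=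
  ⋂₀ {S : Set V | G.IsConvexSet S ∧ A ⊆ S}

/-- `x` is an articulation vertex of `G` if deleting `x` increases the number of
connected components. -/
def SimpleGraph.IsArticulation {V : Type*} (G : SimpleGraph V) (x : V) : Prop :=
  Nat.card G.ConnectedComponent < Nat.card (G.induce {x}ᶜ).ConnectedComponent

/-- `G` is a block graph if every 2-connected induced subgraph (an induced subgraph on at
least 3 vertices that is connected and remains connected after deleting any one vertex)
is complete. -/
def SimpleGraph.IsBlockGraph {V : Type*} (G : SimpleGraph V) : Prop :=
  ∀ S : Set V, 3 ≤ S.ncard → (G.induce S).Connected →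
    (∀ x ∈ S, (G.induce (S \ {x})).Connected) →
    ∀ u ∈ S, ∀ v ∈ S, u ≠ v → G.Adj u v

/-- The join of two graphs: their disjoint union together with all edges between the
two vertex sets. -/
def SimpleGraph.joinGraph {V₁ V₂ : Type*} (G₁ : SimpleGraph V₁) (G₂ : SimpleGraph V₂) :
    SimpleGraph (V₁ ⊕ V₂) :=
  (G₁ ⊕g G₂) ⊔ completeBipartiteGraph V₁ V₂

namespace SimpleGraph

variable {V W : Type*} {G : SimpleGraph V} {P : Set V} {u v w : V}

theorem MutuallyVisible.of_adj (h : G.Adj u v) : G.MutuallyVisible P u v :=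
  ⟨h.toWalk, by simp [dist_eq_one_iff_adj.mpr h], by simp⟩

theorem MutuallyVisible.of_adj_adj (huv : u ≠ v) (huw : G.Adj u w) (hwv : G.Adj w v)
    (hw : w ∉ P) : G.MutuallyVisible P u v := by
  by_cases h : G.Adj u v
  · exact .of_adj h
  · refine ⟨.cons huw hwv.toWalk, ?_, by simpa using hw⟩
    have hle : G.dist u v ≤ 2 := dist_le (.cons huw hwv.toWalk)
    have hpos : 0 < G.dist u v := (huw.reachable.trans hwv.reachable).pos_dist_of_ne huv
    have hne : G.dist u v ≠ 1 := fun h1 => h (dist_eq_one_iff_adj.mp h1)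
    have hlen : (Walk.cons huw hwv.toWalk).length = 2 := rfl
    omega

theorem MutuallyVisible.adj_or_exists_adj_adj (h : G.MutuallyVisible P u v) (huv : u ≠ v)
    (hdist : G.dist u v ≤ 2) : G.Adj u v ∨ ∃ w ∉ P, G.Adj u w ∧ G.Adj w v := by
  obtain ⟨p, hp, hP⟩ := h
  rw [← hp] at hdist
  match p with
  | .nil => exact absurd rfl huv
  | .cons huv .nil => exact .inl huv
  | .cons huw (.cons hwv .nil) => exact .inr ⟨_, hP _ (by simp), huw, hwv⟩
  | .cons _ (.cons _ (.cons _ _)) => simp at hdist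

theorem IsMVSet.ncard_le_mutualVisibilityNumber [Fintype V] (hP : G.IsMVSet P) :
    P.ncard ≤ G.mutualVisibilityNumber := by
  refine le_csSup ⟨Fintype.card V, ?_⟩ ⟨P, hP, rfl⟩
  rintro _ ⟨Q, -, rfl⟩
  exact (Set.ncard_le_card Q).trans_eq Nat.card_eq_fintype_card

theorem mutualVisibilityNumber_le [Fintype V] {k : ℕ}
    (h : ∀ P : Set V, G.IsMVSet P → P.ncard ≤ k) : G.mutualVisibilityNumber ≤ k := by
  refine csSup_le ⟨_, ∅, by simp [IsMVSet], rfl⟩ ?_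
  rintro _ ⟨P, hP, rfl⟩
  exact h P hP

/-- If the vertices of an induced subgraph are pairwise at distance at most two in the ambient
graph, then a mutual-visibility set missing at most one vertex `f a` restricts to one of the
subgraph. -/
theorem IsMVSet.compl_singleton_of_embedding {H : SimpleGraph W} {Q : Set W} (hQ : H.IsMVSet Q)
    (f : G ↪g H) (hf : ∀ u v, H.dist (f u) (f v) ≤ 2) {a : V} (ha : {f a}ᶜ ⊆ Q) :
    G.IsMVSet {a}ᶜ := by
  intro u hu v hv huv
  have hmem : ∀ {x}, x ∈ ({a}ᶜ : Set V) → f x ∈ Q := fun hx =>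
    ha fun h => hx (f.injective h)
  have hfuv := f.injective.ne huv
  obtain h | ⟨w, hw, huw, hwv⟩ :=
    (hQ _ (hmem hu) _ (hmem hv) hfuv).adj_or_exists_adj_adj hfuv (hf u v)
  · exact .of_adj (f.map_adj_iff.mp h)
  · obtain rfl : w = f a := by_contra fun h => hw (ha h)
    exact .of_adj_adj huv (f.map_adj_iff.mp huw) (f.map_adj_iff.mp hwv) (by simp)

theorem ncard_compl_singleton [Fintype V] (a : V) :
    ({a}ᶜ : Set V).ncard = Fintype.card V - 1 := by
  rw [Set.ncard_compl, Set.ncard_singleton, Nat.card_eq_fintype_card]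

theorem exists_compl_singleton_subset [Fintype V] [Nonempty V] {Q : Set V}
    (hQ : Fintype.card V - 1 ≤ Q.ncard) : ∃ x, {x}ᶜ ⊆ Q := by
  have hcompl : Qᶜ.ncard ≤ 1 := by
    have := Set.ncard_add_ncard_compl Q
    rw [Nat.card_eq_fintype_card] at this
    omega
  obtain ⟨x, hx⟩ := (Set.ncard_le_one_iff_subset_singleton (Set.toFinite _)).mp hcompl
  exact ⟨x, Set.compl_subset_comm.mp hx⟩

section Join

variable {V₁ V₂ : Type*} {G₁ : SimpleGraph V₁} {G₂ : SimpleGraph V₂}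

@[simp] theorem joinGraph_adj_inl_inl {u v : V₁} :
    (G₁.joinGraph G₂).Adj (.inl u) (.inl v) ↔ G₁.Adj u v := by
  simp [joinGraph]

@[simp] theorem joinGraph_adj_inr_inr {u v : V₂} :
    (G₁.joinGraph G₂).Adj (.inr u) (.inr v) ↔ G₂.Adj u v := by
  simp [joinGraph]

@[simp] theorem joinGraph_adj_inl_inr {u : V₁} {v : V₂} :
    (G₁.joinGraph G₂).Adj (.inl u) (.inr v) := by
  simp [joinGraph]

@[simp] theorem joinGraph_adj_inr_inl {u : V₂} {v : V₁} :
    (G₁.joinGraph G₂).Adj (.inr u) (.inl v) := by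
  simp [joinGraph]

/-- The left summand as an induced subgraph of the join. -/
def joinGraphInl (G₁ : SimpleGraph V₁) (G₂ : SimpleGraph V₂) : G₁ ↪g G₁.joinGraph G₂ :=
  ⟨.inl, joinGraph_adj_inl_inl⟩

/-- The right summand as an induced subgraph of the join. -/
def joinGraphInr (G₁ : SimpleGraph V₁) (G₂ : SimpleGraph V₂) : G₂ ↪g G₁.joinGraph G₂ :=
  ⟨.inr, joinGraph_adj_inr_inr⟩

theorem joinGraph_isMVSet_compl_pair (a : V₁) (b : V₂) :
    (G₁.joinGraph G₂).IsMVSet {.inl a, .inr b}ᶜ := by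
  rintro (u | u) - (v | v) - huv
  · exact .of_adj_adj (w := .inr b) huv (by simp) (by simp) (by simp)
  · exact .of_adj (by simp)
  · exact .of_adj (by simp)
  · exact .of_adj_adj (w := .inl a) huv (by simp) (by simp) (by simp)

end Join

end SimpleGraph

theorem mu_join_eq_card_sub_two {V₁ V₂ : Type*} [Fintype V₁] [Fintype V₂]
    [Nonempty V₁] [Nonempty V₂] (G₁ : SimpleGraph V₁) (G₂ : SimpleGraph V₂)
    (h₁ : G₁.mutualVisibilityNumber < Fintype.card V₁ - 1)
    (h₂ : G₂.mutualVisibilityNumber < Fintype.card V₂ - 1) :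
    (G₁.joinGraph G₂).mutualVisibilityNumber =
      Fintype.card V₁ + Fintype.card V₂ - 2 := by
  refine le_antisymm (mutualVisibilityNumber_le fun Q hQ => ?_) ?_
  · by_contra! hlt
    obtain ⟨x, hx⟩ : ∃ x, {x}ᶜ ⊆ Q := exists_compl_singleton_subset (by
      rw [Fintype.card_sum]; omega)
    cases x with
    | inl a =>
      have h := hQ.compl_singleton_of_embedding (joinGraphInl G₁ G₂) (fun u v =>
        dist_le (.cons joinGraph_adj_inl_inr
          (.cons (joinGraph_adj_inr_inl (u := Classical.arbitrary V₂)) .nil))) hx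
      have := h.ncard_le_mutualVisibilityNumber
      rw [ncard_compl_singleton] at this
      omega
    | inr b =>
      have h := hQ.compl_singleton_of_embedding (joinGraphInr G₁ G₂) (fun u v =>
        dist_le (.cons joinGraph_adj_inr_inl
          (.cons (joinGraph_adj_inl_inr (u := Classical.arbitrary V₁)) .nil))) hx
      have := h.ncard_le_mutualVisibilityNumber
      rw [ncard_compl_singleton] at this
      omega
  · have h := (joinGraph_isMVSet_compl_pair (G₁ := G₁) (G₂ := G₂) (Classical.arbitrary V₁)
      (Classical.arbitrary V₂)).ncard_le_mutualVisibilityNumber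
    rwa [Set.ncard_compl, Set.ncard_pair (by simp), Nat.card_eq_fintype_card,
      Fintype.card_sum] at h
end

section
/- Let G_1=(V_1,E_1) and G_2=(V_2,E_2) be finite simple graphs with V_1 and V_2 nonempty, let J = G_1 + G_2 be their join and set V = V_1 ∪ V_2. If μ(J) ≠ |V|, then μ(J) = |V| − 1 if and only if μ(G_1) ≥ |V_1| − 1 or μ(G_2) ≥ |V_2| − 1. -/
open SimpleGraph

attribute [local instance] Classical.propDecidable

namespace SimpleGraph

theorem IsMVSet.mono {V : Type*} {G : SimpleGraph V} {P Q : Set V} (hQ : G.IsMVSet Q)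
    (hPQ : P ⊆ Q) : G.IsMVSet P := by
  intro u hu v hv huv
  obtain ⟨p, hp, hw⟩ := hQ u (hPQ hu) v (hPQ hv) huv
  exact ⟨p, hp, fun w hwp hwP => hw w hwp (hPQ hwP)⟩

/-- The complement of a single vertex `w` is a mutual-visibility set exactly when `w` is a common
neighbour of any two distinct nonadjacent vertices other than `w`. -/
theorem isMVSet_compl_singleton_iff {V : Type*} {G : SimpleGraph V} {w : V} :
    G.IsMVSet {w}ᶜ ↔
      ∀ u v, u ≠ w → v ≠ w → u ≠ v → G.Adj u v ∨ (G.Adj u w ∧ G.Adj w v) := by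
  constructor
  · intro h u v hu hv huv
    obtain ⟨p, -, hp⟩ := h u hu v hv huv
    match p, hp with
    | .nil, _ => exact absurd rfl huv
    | .cons h₁ .nil, _ => exact Or.inl h₁
    | .cons (v := x) h₁ (.cons h₂ .nil), hp =>
      have hx : x = w := by simpa using hp x (by simp)
      subst hx
      exact Or.inr ⟨h₁, h₂⟩
    | .cons (v := x) h₁ (.cons (v := y) h₂ (.cons h₃ q)), hp =>
      have hx : x = w := by simpa using hp x (by simp [List.dropLast_cons_of_ne_nil])
      have hy : y = w := by simpa using hp y (by simp [List.dropLast_cons_of_ne_nil])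
      exact absurd (hx.trans hy.symm) h₂.ne
  · intro h u hu v hv huv
    by_cases hadj : G.Adj u v
    · exact ⟨hadj.toWalk, by simp [dist_eq_one_iff_adj.mpr hadj], by simp⟩
    · obtain ⟨h₁, h₂⟩ := (h u v hu hv huv).resolve_left hadj
      let p : G.Walk u v := .cons h₁ h₂.toWalk
      have hlt := p.reachable.one_lt_dist_of_ne_of_not_adj huv hadj
      have hle : G.dist u v ≤ 2 := dist_le p
      have hlen : p.length = 2 := rfl
      exact ⟨p, by omega, by simp [p]⟩

theorem bddAbove_ncard_isMVSet {V : Type*} [Fintype V] (G : SimpleGraph V) :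
    BddAbove {n | ∃ P : Set V, G.IsMVSet P ∧ P.ncard = n} := by
  refine ⟨Fintype.card V, ?_⟩
  rintro _ ⟨P, -, rfl⟩
  simpa using Set.ncard_le_card P

theorem exists_isMVSet_ncard_eq {V : Type*} [Fintype V] (G : SimpleGraph V) :
    ∃ P : Set V, G.IsMVSet P ∧ P.ncard = G.mutualVisibilityNumber :=
  Nat.sSup_mem (s := {n | ∃ P : Set V, G.IsMVSet P ∧ P.ncard = n})
    ⟨0, ∅, by simp [IsMVSet], by simp⟩ G.bddAbove_ncard_isMVSet

theorem mutualVisibilityNumber_le_card {V : Type*} [Fintype V] (G : SimpleGraph V) :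
    G.mutualVisibilityNumber ≤ Fintype.card V := by
  obtain ⟨P, -, hP⟩ := G.exists_isMVSet_ncard_eq
  rw [← hP]
  simpa using Set.ncard_le_card P

theorem card_sub_one_le_mutualVisibilityNumber_iff {V : Type*} [Fintype V] [Nonempty V]
    (G : SimpleGraph V) :
    Fintype.card V - 1 ≤ G.mutualVisibilityNumber ↔ ∃ w, G.IsMVSet {w}ᶜ := by
  constructor
  · intro h
    obtain ⟨P, hP, hcard⟩ := G.exists_isMVSet_ncard_eq
    have hadd := Set.ncard_add_ncard_compl P
    rw [Nat.card_eq_fintype_card] at hadd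
    obtain ⟨w, hw⟩ := (Set.ncard_le_one_iff_subset_singleton).mp (by omega : Pᶜ.ncard ≤ 1)
    exact ⟨w, hP.mono (Set.compl_subset_comm.mp hw)⟩
  · rintro ⟨w, hw⟩
    refine le_csSup G.bddAbove_ncard_isMVSet ⟨_, hw, ?_⟩
    have hadd := Set.ncard_add_ncard_compl {w}
    rw [Nat.card_eq_fintype_card, Set.ncard_singleton] at hadd
    omega

theorem joinGraph_isMVSet_compl_singleton_inl_iff {V₁ V₂ : Type*} {G₁ : SimpleGraph V₁}
    {G₂ : SimpleGraph V₂} {w : V₁} :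
    (G₁.joinGraph G₂).IsMVSet {Sum.inl w}ᶜ ↔ G₁.IsMVSet {w}ᶜ := by
  simp [isMVSet_compl_singleton_iff, joinGraph]

theorem joinGraph_isMVSet_compl_singleton_inr_iff {V₁ V₂ : Type*} {G₁ : SimpleGraph V₁}
    {G₂ : SimpleGraph V₂} {w : V₂} :
    (G₁.joinGraph G₂).IsMVSet {Sum.inr w}ᶜ ↔ G₂.IsMVSet {w}ᶜ := by
  simp [isMVSet_compl_singleton_iff, joinGraph]

end SimpleGraph

theorem mu_join_eq_card_sub_one_iff {V₁ V₂ : Type*} [Fintype V₁] [Fintype V₂]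
    [Nonempty V₁] [Nonempty V₂] (G₁ : SimpleGraph V₁) (G₂ : SimpleGraph V₂)
    (h : (G₁.joinGraph G₂).mutualVisibilityNumber ≠ Fintype.card V₁ + Fintype.card V₂) :
    (G₁.joinGraph G₂).mutualVisibilityNumber = Fintype.card V₁ + Fintype.card V₂ - 1 ↔
      Fintype.card V₁ - 1 ≤ G₁.mutualVisibilityNumber ∨
        Fintype.card V₂ - 1 ≤ G₂.mutualVisibilityNumber := by
  have hle := (G₁.joinGraph G₂).mutualVisibilityNumber_le_card
  have hiff := (G₁.joinGraph G₂).card_sub_one_le_mutualVisibilityNumber_iff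
  rw [Fintype.card_sum] at hle hiff
  rw [card_sub_one_le_mutualVisibilityNumber_iff, card_sub_one_le_mutualVisibilityNumber_iff]
  simp only [Sum.exists, joinGraph_isMVSet_compl_singleton_inl_iff,
    joinGraph_isMVSet_compl_singleton_inr_iff] at hiff
  rw [← hiff]
  omega
end
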